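/- arXiv:2302.04859 — 9 statements merged into one kernel-verified Lean document; each statement's English description precedes it below -/
import Mathlib

section
/- Let K ⊂ ℝⁿ be a convex and compact set, let A be an n×n symmetric positive definite matrix, let y ∈ ℝⁿ, let g ∈ ℝⁿ, let Q ≥ 0 and C > 0 satisfy C ≥ ‖g‖_A, and suppose that (y − z)ᵀ A g ≥ Q for every z ∈ K. Then the point ỹ = y − (Q/C²) g satisfies ‖ỹ − z‖_A² ≤ ‖y − z‖_A² − (Q/C)² for every z ∈ K. -/
open Matrix

/-- The `A`-norm `‖x‖_A = √(xᵀ A x)`. -/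
noncomputable def Anorm {n : ℕ} (A : Matrix (Fin n) (Fin n) ℝ) (x : Fin n → ℝ) : ℝ :=
  Real.sqrt (x ⬝ᵥ A.mulVec x)

theorem Anorm_sq {n : ℕ} {A : Matrix (Fin n) (Fin n) ℝ} (hA : A.PosSemidef) (x : Fin n → ℝ) :
    Anorm A x ^ 2 = x ⬝ᵥ A.mulVec x :=
  Real.sq_sqrt (by simpa using hA.dotProduct_mulVec_nonneg x)

theorem Anorm_sub_smul_sq {n : ℕ} {A : Matrix (Fin n) (Fin n) ℝ} (hA : A.PosSemidef)
    (t : ℝ) (u g : Fin n → ℝ) :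
    Anorm A (u - t • g) ^ 2 =
      Anorm A u ^ 2 - 2 * t * (u ⬝ᵥ A.mulVec g) + t ^ 2 * Anorm A g ^ 2 := by
  have hsymm : g ⬝ᵥ A.mulVec u = u ⬝ᵥ A.mulVec g := by
    have hT : Aᵀ = A := by simpa [Matrix.IsHermitian] using hA.isHermitian
    rw [dotProduct_mulVec, ← mulVec_transpose, hT, dotProduct_comm]
  simp only [Anorm_sq hA, mulVec_sub, mulVec_smul, dotProduct_sub, sub_dotProduct,
    smul_dotProduct, dotProduct_smul, smul_eq_mul, hsymm]
  ring

/-- pulling an infeasible point closer to `K` using a generalized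
separating hyperplane (Lemma 2 of the paper). -/
theorem pull_step_with_separating_hyperplane {n : ℕ}
    (K : Set (Fin n → ℝ)) (hKconv : Convex ℝ K) (hKcomp : IsCompact K)
    (A : Matrix (Fin n) (Fin n) ℝ) (hA : A.PosDef)
    (y g : Fin n → ℝ) (Q C : ℝ) (hQ : 0 ≤ Q) (hC : 0 < C)
    (hCg : Anorm A g ≤ C)
    (hsep : ∀ z ∈ K, Q ≤ (y - z) ⬝ᵥ A.mulVec g) :
    ∀ z ∈ K,
      Anorm A (y - (Q / C ^ 2) • g - z) ^ 2 ≤ Anorm A (y - z) ^ 2 - (Q / C) ^ 2 := by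
  intro z hz
  have hgC : Anorm A g ^ 2 ≤ C ^ 2 := pow_le_pow_left₀ (Real.sqrt_nonneg _) hCg 2
  have ht : 0 ≤ Q / C ^ 2 := by positivity
  rw [sub_right_comm, Anorm_sub_smul_sq hA.posSemidef]
  have hlin := mul_le_mul_of_nonneg_left (hsep z hz) ht
  have hquad := mul_le_mul_of_nonneg_left hgC (sq_nonneg (Q / C ^ 2))
  have h₁ : Q / C ^ 2 * Q = (Q / C) ^ 2 := by ring
  have h₂ : (Q / C ^ 2) ^ 2 * C ^ 2 = (Q / C) ^ 2 := by field_simp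
  linarith
end

section
/- Let K ⊂ ℝⁿ be a convex and compact set, let A be an n×n symmetric positive definite matrix, let y ∈ ℝⁿ, let ε > 0, and let x̃ ∈ K be such that (x̃ − y)ᵀ A (x̃ − v) ≤ ε for every v ∈ K and ‖x̃ − y‖_A² > 3ε. Then for every z ∈ K it holds that (y − z)ᵀ A (y − x̃) > (2/3)‖x̃ − y‖_A². -/
open Matrix

/-- a Frank-Wolfe point with small dual gap which is still far from `y`
yields a generalized separating hyperplane with margin `(2/3)‖x̃ - y‖_A²`. -/
theorem separating_hyperplane_from_dual_gap {n : ℕ}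
    (K : Set (Fin n → ℝ)) (hKconv : Convex ℝ K) (hKcomp : IsCompact K)
    (A : Matrix (Fin n) (Fin n) ℝ) (hA : A.PosDef)
    (y : Fin n → ℝ) (ε : ℝ) (hε : 0 < ε)
    (xt : Fin n → ℝ) (hxt : xt ∈ K)
    (hgap : ∀ v ∈ K, (xt - y) ⬝ᵥ A.mulVec (xt - v) ≤ ε)
    (hfar : 3 * ε < Anorm A (xt - y) ^ 2) :
    ∀ z ∈ K, (2 / 3) * Anorm A (xt - y) ^ 2 < (y - z) ⬝ᵥ A.mulVec (y - xt) := by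
  intro z hz
  have hsymm : Aᵀ = A := by simpa using hA.isHermitian.eq
  have hnorm : Anorm A (xt - y) ^ 2 = (xt - y) ⬝ᵥ A.mulVec (xt - y) :=
    Real.sq_sqrt (by simpa using hA.posSemidef.dotProduct_mulVec_nonneg (xt - y))
  have hswap : (y - z) ⬝ᵥ A.mulVec (y - xt) = (y - xt) ⬝ᵥ A.mulVec (y - z) := by
    rw [dotProduct_mulVec, ← mulVec_transpose, hsymm, dotProduct_comm]
  have hsplit : (y - xt) ⬝ᵥ A.mulVec (y - z) =
      (xt - y) ⬝ᵥ A.mulVec (xt - y) - (xt - y) ⬝ᵥ A.mulVec (xt - z) := by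
    rw [← dotProduct_sub, ← mulVec_sub, ← neg_sub xt y, ← neg_sub z y, neg_dotProduct,
      mulVec_neg, dotProduct_neg, neg_neg, sub_sub_sub_cancel_left]
  have := hgap z hz
  linarith
end

section
/- Let K ⊂ ℝⁿ be a nonempty convex and compact set, let A be an n×n symmetric positive definite matrix, let y ∈ ℝⁿ, let ε > 0, and let x̃ ∈ K be such that (x̃ − y)ᵀ A (x̃ − v) ≤ ε for every v ∈ K. If dist_A(y, K)² ≤ ε, then ‖x̃ − y‖_A² ≤ 3ε. -/
open Matrix

/-- The `A`-distance from a point `y` to the set `K`: `dist_A(y, K) = min_{z ∈ K} ‖y - z‖_A`. -/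
noncomputable def distA {n : ℕ} (A : Matrix (Fin n) (Fin n) ℝ) (y : Fin n → ℝ)
    (K : Set (Fin n → ℝ)) : ℝ := sInf ((fun z => Anorm A (y - z)) '' K)

theorem continuous_Anorm {n : ℕ} (A : Matrix (Fin n) (Fin n) ℝ) : Continuous (Anorm A) := by
  unfold Anorm
  fun_prop

theorem exists_Anorm_sub_eq_distA {n : ℕ} (A : Matrix (Fin n) (Fin n) ℝ) (y : Fin n → ℝ)
    {K : Set (Fin n → ℝ)} (hne : K.Nonempty) (hK : IsCompact K) :
    ∃ v ∈ K, Anorm A (y - v) = distA A y K :=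
  (hK.image ((continuous_Anorm A).comp (continuous_const.sub continuous_id))).sInf_mem
    (hne.image _)

theorem dotProduct_mulVec_comm_of_isSymm {n : ℕ} {A : Matrix (Fin n) (Fin n) ℝ}
    (hA : A.IsSymm) (x z : Fin n → ℝ) : x ⬝ᵥ A.mulVec z = z ⬝ᵥ A.mulVec x := by
  rw [dotProduct_mulVec, ← mulVec_transpose, hA.eq, dotProduct_comm]

/-- if the `A`-distance of `y` from `K` is at most `√ε` and `x̃ ∈ K` has dual
gap at most `ε`, then `‖x̃ - y‖_A² ≤ 3ε`. -/
theorem close_point_from_small_dual_gap {n : ℕ}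
    (K : Set (Fin n → ℝ)) (hKne : K.Nonempty) (hKconv : Convex ℝ K) (hKcomp : IsCompact K)
    (A : Matrix (Fin n) (Fin n) ℝ) (hA : A.PosDef)
    (y : Fin n → ℝ) (ε : ℝ) (hε : 0 < ε)
    (xt : Fin n → ℝ) (hxt : xt ∈ K)
    (hgap : ∀ v ∈ K, (xt - y) ⬝ᵥ A.mulVec (xt - v) ≤ ε)
    (hdist : distA A y K ^ 2 ≤ ε) :
    Anorm A (xt - y) ^ 2 ≤ 3 * ε := by
  obtain ⟨v, hv, hvd⟩ := exists_Anorm_sub_eq_distA A y hKne hKcomp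
  have hsymm : A.IsSymm := by
    simpa [Matrix.IsHermitian, Matrix.IsSymm] using hA.isHermitian
  rw [← hvd, Anorm_sq hA.posSemidef] at hdist
  rw [Anorm_sq hA.posSemidef]
  have hg := hgap v hv
  have hpos : 0 ≤ (xt - v) ⬝ᵥ A.mulVec (xt - v) := by
    simpa using hA.posSemidef.dotProduct_mulVec_nonneg (xt - v)
  have hcomm := dotProduct_mulVec_comm_of_isSymm hsymm (xt - y) (y - v)
  rw [← sub_add_sub_cancel xt y v] at hg hpos
  simp only [mulVec_add, dotProduct_add, add_dotProduct] at hg hpos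
  linarith
end

section
/- Let K ⊂ ℝⁿ be a nonempty convex and compact set, let A be an n×n symmetric positive definite matrix, let y ∈ ℝⁿ, and let x̃ ∈ K. Then ‖x̃ − y‖_A² − dist_A(y, K)² ≤ 2 · max_{v ∈ K} (x̃ − y)ᵀ A (x̃ − v). -/
open Matrix

theorem dotProduct_mulVec_comm_of_isHermitian {n : ℕ} {A : Matrix (Fin n) (Fin n) ℝ}
    (hA : A.IsHermitian) (u w : Fin n → ℝ) : u ⬝ᵥ A.mulVec w = w ⬝ᵥ A.mulVec u := by
  have hAT : Aᵀ = A := by simpa [Matrix.IsHermitian] using hA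
  rw [dotProduct_mulVec, ← mulVec_transpose, hAT, dotProduct_comm]

/-- the squared `A`-distance gap of a feasible point `x̃` is at most twice
the maximal dual gap `max_{v ∈ K} (x̃ - y)ᵀ A (x̃ - v)`. -/
theorem distance_gap_le_twice_dual_gap {n : ℕ}
    (K : Set (Fin n → ℝ)) (hKne : K.Nonempty) (hKconv : Convex ℝ K) (hKcomp : IsCompact K)
    (A : Matrix (Fin n) (Fin n) ℝ) (hA : A.PosDef)
    (y : Fin n → ℝ) (xt : Fin n → ℝ) (hxt : xt ∈ K) :
    Anorm A (xt - y) ^ 2 - distA A y K ^ 2 ≤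
      2 * sSup ((fun v => (xt - y) ⬝ᵥ A.mulVec (xt - v)) '' K) := by
  obtain ⟨z, hz, hdist⟩ : distA A y K ∈ (fun z => Anorm A (y - z)) '' K :=
    (hKcomp.image ((continuous_Anorm A).comp (by fun_prop))).sInf_mem (hKne.image _)
  have hsup : (xt - y) ⬝ᵥ A.mulVec (xt - z) ≤
      sSup ((fun v => (xt - y) ⬝ᵥ A.mulVec (xt - v)) '' K) :=
    le_csSup (hKcomp.image (by fun_prop)).bddAbove ⟨z, hz, rfl⟩
  have hw : 0 ≤ (xt - z) ⬝ᵥ A.mulVec (xt - z) := by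
    simpa using hA.posSemidef.dotProduct_mulVec_nonneg (xt - z)
  have hsymm := dotProduct_mulVec_comm_of_isHermitian hA.isHermitian (xt - y) (xt - z)
  have hyz : y - z = (xt - z) - (xt - y) := by abel
  rw [← hdist, Anorm_sq hA.posSemidef, Anorm_sq hA.posSemidef, hyz]
  generalize xt - z = w at *
  generalize xt - y = u at *
  rw [mulVec_sub, sub_dotProduct, dotProduct_sub, dotProduct_sub]
  linarith
end

section
/- Let A and B be n×n symmetric positive definite matrices. Then Tr(A⁻¹(A − B)) ≤ ln(det A / det B). -/
open Matrix

/-- The logarithm of the determinant of a positive definite matrix is at most its trace minus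
its size. -/
theorem Matrix.PosDef.log_det_le_trace_sub_card {ι : Type*} [Fintype ι] [DecidableEq ι]
    {M : Matrix ι ι ℝ} (hM : M.PosDef) : Real.log M.det ≤ M.trace - Fintype.card ι := by
  have h_pos := hM.eigenvalues_pos
  calc Real.log M.det = ∑ i, Real.log (hM.isHermitian.eigenvalues i) := by
        rw [hM.isHermitian.det_eq_prod_eigenvalues]
        exact Real.log_prod fun i _ => (h_pos i).ne'
    _ ≤ ∑ i, (hM.isHermitian.eigenvalues i - 1) :=
        Finset.sum_le_sum fun i _ => Real.log_le_sub_one_of_pos (h_pos i)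
    _ = M.trace - Fintype.card ι := by
        simp [hM.isHermitian.trace_eq_sum_eigenvalues]

open scoped MatrixOrder in
/-- A positive definite real matrix is `Cᴴ * C` for some invertible `C`. -/
theorem Matrix.PosDef.exists_isUnit_eq_conjTranspose_mul_self {ι : Type*} [Fintype ι]
    [DecidableEq ι] {M : Matrix ι ι ℝ} (hM : M.PosDef) :
    ∃ C : Matrix ι ι ℝ, IsUnit C ∧ M = Cᴴ * C :=
  CStarAlgebra.isStrictlyPositive_iff_eq_star_mul_self.mp hM.isStrictlyPositive

/-- for positive definite matrices `A, B`,
`Tr(A⁻¹(A − B)) ≤ ln(det A / det B)`. -/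
theorem trace_inv_mul_sub_le_log_det_div {n : ℕ}
    (A B : Matrix (Fin n) (Fin n) ℝ) (hA : A.PosDef) (hB : B.PosDef) :
    (A⁻¹ * (A - B)).trace ≤ Real.log (A.det / B.det) := by
  obtain ⟨C, hC, hAC⟩ := hA.inv.exists_isUnit_eq_conjTranspose_mul_self
  have h_trace : (C * B * Cᴴ).trace = (A⁻¹ * B).trace := by
    rw [hAC, trace_mul_comm, Matrix.mul_assoc]
  have h_det : (C * B * Cᴴ).det = (A.det / B.det)⁻¹ := by
    have h := congrArg det hAC
    rw [det_nonsing_inv, Ring.inverse_eq_inv', det_mul] at h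
    rw [det_mul, det_mul, inv_div, div_eq_mul_inv, h]
    ring
  have h := (hB.mul_mul_conjTranspose_same
    (vecMul_injective_of_isUnit hC)).log_det_le_trace_sub_card
  rw [h_trace, h_det, Real.log_inv, Fintype.card_fin] at h
  rw [Matrix.mul_sub, nonsing_inv_mul A ((isUnit_iff_isUnit_det A).mp hA.isUnit), trace_sub,
    trace_one, Fintype.card_fin]
  linarith
end

section
/- Let C ⊂ ℝⁿ be a convex and compact set contained in the Euclidean ball of radius R centered at the origin, let α > 0, G > 0, and let f₁, …, f_k : C → ℝ be differentiable functions whose gradients are bounded in Euclidean norm by G on C and which each satisfy the curvature condition with parameter α over C. Define h(x) = Σ_{i=1}^{k} f_i(x). Then for every η ≥ max{4kGR, 2k/α} and every x, y ∈ C it holds that h(x) − h(y) ≤ ∇h(x)ᵀ(x − y) − (1/(2η)) · (∇h(x)ᵀ(x − y))². -/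
open scoped RealInnerProductSpace

/-- a sum of `k` functions, each satisfying the curvature condition with
parameter `α` and gradients bounded by `G` over a convex compact set `C ⊆ R·B`, satisfies
the analogous inequality for every `η ≥ max{4kGR, 2k/α}`. -/
theorem sum_satisfies_curvature_condition {n k : ℕ} (R G α : ℝ)
    (hR : 0 < R) (hG : 0 < G) (hα : 0 < α)
    (C : Set (EuclideanSpace ℝ (Fin n))) (hCconv : Convex ℝ C) (hCcomp : IsCompact C)
    (hCR : C ⊆ Metric.closedBall 0 R)
    (f : Fin k → EuclideanSpace ℝ (Fin n) → ℝ)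
    (g : Fin k → EuclideanSpace ℝ (Fin n) → EuclideanSpace ℝ (Fin n))
    (hgrad : ∀ i, ∀ x ∈ C, HasGradientAt (f i) (g i x) x)
    (hGbound : ∀ i, ∀ x ∈ C, ‖g i x‖ ≤ G)
    (hcurv : ∀ i, ∀ η : ℝ, max (4 * G * R) (2 / α) ≤ η → ∀ x ∈ C, ∀ y ∈ C,
      f i x - f i y ≤ ⟪g i x, x - y⟫ - 1 / (2 * η) * ⟪g i x, x - y⟫ ^ 2) :
    ∀ η : ℝ, max (4 * (k : ℝ) * G * R) (2 * (k : ℝ) / α) ≤ η → ∀ x ∈ C, ∀ y ∈ C,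
      (∑ i, f i x) - (∑ i, f i y) ≤
        ⟪∑ i, g i x, x - y⟫ - 1 / (2 * η) * ⟪∑ i, g i x, x - y⟫ ^ 2 := by
  intro η hη x hx y hy
  rcases Nat.eq_zero_or_pos k with rfl | hk
  · simp
  have hk' : (0 : ℝ) < k := Nat.cast_pos.mpr hk
  have hη0 : 0 < η := lt_of_lt_of_le (by positivity) ((le_max_right _ _).trans hη)
  have hηk : max (4 * G * R) (2 / α) ≤ η / k := by
    rw [le_div_iff₀ hk', max_mul_of_nonneg _ _ hk'.le,
      show 4 * G * R * k = 4 * k * G * R by ring, show 2 / α * k = 2 * k / α by ring]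
    exact hη
  have hsum := Finset.sum_le_sum fun i (_ : i ∈ Finset.univ) => hcurv i (η / k) hηk x hx y hy
  have hcauchy : (∑ i, ⟪g i x, x - y⟫) ^ 2 ≤ k * ∑ i, ⟪g i x, x - y⟫ ^ 2 := by
    simpa using sq_sum_le_card_mul_sum_sq (s := Finset.univ) (f := fun i => ⟪g i x, x - y⟫)
  rw [Finset.sum_sub_distrib, Finset.sum_sub_distrib, ← Finset.mul_sum] at hsum
  rw [sum_inner]
  refine hsum.trans (sub_le_sub_left ?_ _)
  calc 1 / (2 * η) * (∑ i, ⟪g i x, x - y⟫) ^ 2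
      ≤ 1 / (2 * η) * (k * ∑ i, ⟪g i x, x - y⟫ ^ 2) := by gcongr
    _ = 1 / (2 * (η / k)) * ∑ i, ⟪g i x, x - y⟫ ^ 2 := by field_simp
end

section
/- Let ε > 0, let v₁, …, v_M ∈ ℝⁿ, and define A₀ = ε·Iₙ and A_m = A_{m−1} + v_m v_mᵀ for m = 1, …, M. Then Σ_{m=1}^{M} v_mᵀ A_m⁻¹ v_m ≤ ln(det A_M / det A₀). -/
open Matrix

/-- Matrix determinant lemma for subtracting a rank-one matrix. -/
lemma Matrix.det_sub_vecMulVec {ι R : Type*} [Fintype ι] [DecidableEq ι] [CommRing R]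
    {B : Matrix ι ι R} (hB : IsUnit B.det) (u w : ι → R) :
    (B - vecMulVec u w).det = B.det * (1 - w ⬝ᵥ B⁻¹ *ᵥ u) := by
  have h := det_add_replicateCol_mul_replicateRow (ι := Unit) hB (-u) w
  rw [← vecMulVec_eq Unit, neg_vecMulVec, ← sub_eq_add_neg] at h
  rw [h, det_unique (n := Unit), Matrix.mul_assoc, ← replicateCol_mulVec]
  simp [mulVec_neg, sub_eq_add_neg, replicateRow_mul_replicateCol_apply]

lemma Matrix.PosDef.add_vecMulVec_self {ι : Type*} [Fintype ι] {B : Matrix ι ι ℝ}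
    (hB : B.PosDef) (u : ι → ℝ) : (B + vecMulVec u u).PosDef :=
  hB.add_posSemidef (by simpa using posSemidef_vecMulVec_self_star u)

lemma Matrix.PosDef.dotProduct_inv_mulVec_le_log_det {ι : Type*} [Fintype ι] [DecidableEq ι]
    {B : Matrix ι ι ℝ} (hB : B.PosDef) (u : ι → ℝ) :
    u ⬝ᵥ (B + vecMulVec u u)⁻¹ *ᵥ u ≤ Real.log ((B + vecMulVec u u).det / B.det) := by
  have hC := (hB.add_vecMulVec_self u).det_pos
  have h := det_sub_vecMulVec hC.ne'.isUnit u u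
  rw [add_sub_cancel_right] at h
  have hlog := Real.one_sub_inv_le_log_of_pos (div_pos hC hB.det_pos)
  have hquot : ((B + vecMulVec u u).det / B.det)⁻¹ =
      1 - u ⬝ᵥ (B + vecMulVec u u)⁻¹ *ᵥ u := by
    rw [inv_div, div_eq_iff hC.ne', mul_comm]
    exact h
  linarith

/-- the telescoping log-det bound for rank-one updates
`A_m = A_{m-1} + v_m v_mᵀ` starting from `A₀ = ε·I`. -/
theorem sum_quadratic_inv_le_log_det_ratio {n : ℕ} (ε : ℝ) (hε : 0 < ε) (M : ℕ)
    (v : ℕ → (Fin n → ℝ)) (A : ℕ → Matrix (Fin n) (Fin n) ℝ)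
    (hA0 : A 0 = ε • (1 : Matrix (Fin n) (Fin n) ℝ))
    (hArec : ∀ m, 1 ≤ m → m ≤ M → A m = A (m - 1) + vecMulVec (v m) (v m)) :
    ∑ m ∈ Finset.Icc 1 M, v m ⬝ᵥ (A m)⁻¹.mulVec (v m) ≤
      Real.log ((A M).det / (A 0).det) := by
  have h0 : (A 0).PosDef := hA0 ▸ PosDef.one.smul hε
  suffices H : ∀ k ≤ M, (A k).PosDef ∧
      ∑ m ∈ Finset.Icc 1 k, v m ⬝ᵥ (A m)⁻¹.mulVec (v m) ≤
        Real.log ((A k).det / (A 0).det) from (H M le_rfl).2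
  intro k
  induction k with
  | zero => exact fun _ => ⟨h0, by simp [div_self h0.det_pos.ne']⟩
  | succ k ih =>
    intro hk
    obtain ⟨hpos, hsum⟩ := ih (by omega)
    have hrec : A (k + 1) = A k + vecMulVec (v (k + 1)) (v (k + 1)) :=
      hArec (k + 1) (by omega) hk
    have hpos' : (A (k + 1)).PosDef := hrec ▸ hpos.add_vecMulVec_self _
    have hstep := hpos.dotProduct_inv_mulVec_le_log_det (v (k + 1))
    rw [← hrec, Real.log_div hpos'.det_pos.ne' hpos.det_pos.ne'] at hstep
    rw [Real.log_div hpos.det_pos.ne' h0.det_pos.ne'] at hsum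
    refine ⟨hpos', ?_⟩
    rw [Finset.sum_Icc_succ_top (by omega), Real.log_div hpos'.det_pos.ne' h0.det_pos.ne']
    linarith
end

section
/- Let ε > 0, let v₁, …, v_M ∈ ℝⁿ with Σ_{m=1}^{M} ‖v_m‖² ≤ S for some S > 0, let W = Σ_{m=1}^{M} v_m v_mᵀ, and let ρ ∈ {1, …, n}. Then ln det(ε·Iₙ + W) − n·ln ε ≤ ρ·ln(1 + S/ε) + (1/ε)·Σ_{i=ρ+1}^{n} λ_i(W), where λ_i(W) denotes the i-th largest eigenvalue of W. -/
open Matrix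

/-- The `i`-th largest eigenvalue (0-indexed: `eigDesc hA 0` is the largest) of a
symmetric real matrix. -/
noncomputable def eigDesc {n : ℕ} {A : Matrix (Fin n) (Fin n) ℝ} (hA : A.IsHermitian)
    (i : Fin n) : ℝ := hA.eigenvalues (Tuple.sort hA.eigenvalues i.rev)

/-- The determinant of a shift of a symmetric real matrix is the product of the shifted
eigenvalues. -/
theorem det_smul_one_add_eq_prod_eigenvalues {n : ℕ} {A : Matrix (Fin n) (Fin n) ℝ}
    (hA : A.IsHermitian) (t : ℝ) :
    (t • (1 : Matrix (Fin n) (Fin n) ℝ) + A).det = ∏ i, (t + hA.eigenvalues i) := by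
  have h := A.eval_charpoly (-t)
  rw [hA.charpoly_eq, Polynomial.eval_prod] at h
  have hneg : scalar (Fin n) (-t) - A = -(t • (1 : Matrix (Fin n) (Fin n) ℝ) + A) := by
    rw [map_neg, scalar_apply, ← smul_one_eq_diagonal]
    abel
  have hfac : ∀ i, Polynomial.eval (-t)
      (Polynomial.X - Polynomial.C ((hA.eigenvalues i : ℝ))) = -(t + hA.eigenvalues i) := by
    intro i
    rw [Polynomial.eval_sub, Polynomial.eval_X, Polynomial.eval_C]
    ring
  simp only [RCLike.ofReal_real_eq_id, id_eq] at h
  rw [hneg, det_neg, Finset.prod_congr rfl fun i _ => hfac i, Finset.prod_neg,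
    Finset.card_univ] at h
  exact (mul_left_cancel₀ (pow_ne_zero _ (by norm_num)) h).symm

/-- Reindexing the eigenvalues in decreasing order does not change symmetric sums. -/
theorem sum_eigDesc {n : ℕ} {A : Matrix (Fin n) (Fin n) ℝ} (hA : A.IsHermitian) (f : ℝ → ℝ) :
    ∑ i, f (eigDesc hA i) = ∑ i, f (hA.eigenvalues i) :=
  Equiv.sum_comp (Fin.revPerm.trans (Tuple.sort hA.eigenvalues))
    (fun i => f (hA.eigenvalues i))

/-- log-det bound in terms of the `ρ` largest eigenvalues and the tail
eigenvalues of `W = Σ_m v_m v_mᵀ`. Here `∑_{i=ρ+1}^n λ_i(W)` (1-indexed) corresponds to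
the sum of `eigDesc hW i` over 0-indexed `i` with `ρ ≤ i`. -/
theorem log_det_le_rho_split {n : ℕ} (ε S : ℝ) (hε : 0 < ε) (hS : 0 < S) (M : ℕ)
    (v : Fin M → (Fin n → ℝ)) (hvS : ∑ m, v m ⬝ᵥ v m ≤ S)
    (W : Matrix (Fin n) (Fin n) ℝ) (hW : W = ∑ m, vecMulVec (v m) (v m))
    (hWh : W.IsHermitian) (ρ : ℕ) (hρ1 : 1 ≤ ρ) (hρn : ρ ≤ n) :
    Real.log (ε • (1 : Matrix (Fin n) (Fin n) ℝ) + W).det - (n : ℝ) * Real.log ε ≤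
      (ρ : ℝ) * Real.log (1 + S / ε) +
        (1 / ε) * ∑ i ∈ Finset.univ.filter (fun i : Fin n => ρ ≤ (i : ℕ)), eigDesc hWh i := by
  have hpsd : W.PosSemidef := by
    rw [hW]
    exact posSemidef_sum _ fun m _ => by simpa using posSemidef_vecMulVec_self_star (v m)
  have hnn : ∀ i, 0 ≤ eigDesc hWh i := fun i => hpsd.eigenvalues_nonneg _
  have htr : ∑ i, eigDesc hWh i ≤ S := by
    have h1 := sum_eigDesc hWh id
    have h2 := hWh.trace_eq_sum_eigenvalues
    have h3 : W.trace = ∑ m, v m ⬝ᵥ v m := by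
      rw [hW, trace_sum]
      simp [trace_vecMulVec]
    simp only [id_eq, RCLike.ofReal_real_eq_id] at h1 h2
    linarith
  have hle : ∀ i, eigDesc hWh i ≤ S := fun i =>
    (Finset.single_le_sum (fun j _ => hnn j) (Finset.mem_univ i)).trans htr
  have hlog : Real.log (ε • (1 : Matrix (Fin n) (Fin n) ℝ) + W).det - (n : ℝ) * Real.log ε =
      ∑ i, Real.log (1 + eigDesc hWh i / ε) := by
    have hterm : ∀ i, Real.log (1 + eigDesc hWh i / ε) =
        Real.log (ε + eigDesc hWh i) - Real.log ε := by
      intro i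
      rw [← Real.log_div (by linarith [hnn i]) hε.ne', add_div, div_self hε.ne']
    rw [det_smul_one_add_eq_prod_eigenvalues hWh, Real.log_prod fun i _ =>
      (add_pos_of_pos_of_nonneg hε (hpsd.eigenvalues_nonneg i)).ne',
      Finset.sum_congr rfl fun i _ => hterm i, Finset.sum_sub_distrib,
      sum_eigDesc hWh fun x => Real.log (ε + x)]
    simp
  have hcard : (Finset.univ.filter fun i : Fin n => ¬ ρ ≤ (i : ℕ)).card = ρ := by
    simp only [not_le, Fin.card_filter_val_lt]
    exact min_eq_right hρn
  rw [hlog, ← Finset.sum_filter_not_add_sum_filter _ (fun i : Fin n => ρ ≤ (i : ℕ))]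
  refine add_le_add ?_ ?_
  · refine (Finset.sum_le_card_nsmul _ _ (Real.log (1 + S / ε)) fun i _ => ?_).trans_eq ?_
    · have := div_nonneg (hnn i) hε.le
      have := hle i
      exact Real.log_le_log (by linarith) (by gcongr)
    · rw [hcard, nsmul_eq_mul]
  · rw [Finset.mul_sum]
    refine Finset.sum_le_sum fun i _ => ?_
    have hx := div_nonneg (hnn i) hε.le
    have := Real.log_le_sub_one_of_pos (x := 1 + eigDesc hWh i / ε) (by linarith)
    rw [one_div_mul_eq_div]
    linarith
end

section
/- Let K ⊂ ℝⁿ be a nonempty convex and compact set contained in the Euclidean ball 3R·B of radius 3R centered at the origin, with K itself contained in the ball of radius R (where R > 0). Let T and K' be positive integers with K' dividing T, let α > 0, β ≥ 0, G > 0, ε > 0, and let ε_I ≥ G²K'² and η ≥ max{12K'GR, 2K'/α}. Let f₁, …, f_T : 3R·B → ℝ be convex differentiable functions that are β-smooth over 3R·B, have gradients bounded in Euclidean norm by G over 3R·B, and each satisfy the curvature condition with parameter α over 3R·B. Let x₁ = ỹ₁ ∈ K and A₀ = ε_I·Iₙ, and for m = 1, …, T/K': set ∇_t = ∇f_t(ỹ_m)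 for each t with (m−1)K' < t ≤ mK' and ∇̄_m = Σ_{t=(m−1)K'+1}^{mK'} ∇_t; let A_m be a symmetric matrix with A_m − A₀ and (A_{m−1} + ∇̄_m∇̄_mᵀ) − A_m both positive semidefinite; set y_{m+1} = ỹ_m − η A_m⁻¹ ∇̄_m; and let x_{m+1} ∈ K and ỹ_{m+1} ∈ ℝⁿ satisfy ‖ỹ_{m+1} − z‖_{A_m} ≤ ‖y_{m+1} − z‖_{A_m} for every z ∈ K and ‖x_{m+1} − ỹ_{m+1}‖_{A_m}² ≤ 3ε. Assume further that ỹ_m ∈ 3R·B for every m. Then for every x ∈ K: Σ_{t=1}^{T} (f_t(x_{⌈t/K'⌉}) − f_t(x)) ≤ (3βε/ε_I)·T + √((6εT/K') · Σ_{m=1}^{T/K'} ∇̄_mᵀ A_m⁻¹ ∇̄_m) + 2R²ε_I/η + (η/2) · Σ_{m=1}^{T/K'} ∇̄_mᵀ A_m⁻¹ ∇̄_m. -/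
open scoped RealInnerProductSpace

/-- View a Euclidean vector as a plain function `Fin n → ℝ`. -/
def toVec {n : ℕ} (v : EuclideanSpace ℝ (Fin n)) : Fin n → ℝ := v

/-- Matrix-vector multiplication on Euclidean space. -/
noncomputable def mulVecE {n : ℕ} (A : Matrix (Fin n) (Fin n) ℝ)
    (v : EuclideanSpace ℝ (Fin n)) : EuclideanSpace ℝ (Fin n) := Matrix.toEuclideanLin A v

/-- The `A`-norm `‖x‖_A = √(xᵀ A x)` on Euclidean space. -/
noncomputable def AnormE {n : ℕ} (A : Matrix (Fin n) (Fin n) ℝ)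
    (x : EuclideanSpace ℝ (Fin n)) : ℝ := Real.sqrt ⟪x, mulVecE A x⟫

/-- Splitting a sum over `{1, …, K * M}` into `M` consecutive blocks of length `K`. -/
lemma sum_Icc_mul_eq_sum_blocks {K : ℕ} (hK : 0 < K) (g : ℕ → ℕ → ℝ) (M : ℕ) :
    ∑ t ∈ Finset.Icc 1 (K * M), g t ((t + K - 1) / K) =
      ∑ m ∈ Finset.Icc 1 M, ∑ t ∈ Finset.Icc ((m - 1) * K + 1) (m * K), g t m := by
  induction M with
  | zero => simp
  | succ M ih =>
    rw [Finset.sum_Icc_succ_top (by omega), ← ih]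
    have hunion : Finset.Icc 1 (K * (M + 1)) =
        Finset.Icc 1 (K * M) ∪ Finset.Icc (M * K + 1) ((M + 1) * K) := by
      ext t
      simp only [Finset.mem_union, Finset.mem_Icc]
      have : (M + 1) * K = K * M + K := by ring
      have : K * (M + 1) = K * M + K := by ring
      have : M * K = K * M := by ring
      omega
    have hdisj : Disjoint (Finset.Icc 1 (K * M)) (Finset.Icc (M * K + 1) ((M + 1) * K)) := by
      rw [Finset.disjoint_left]
      intro t h₁ h₂
      simp only [Finset.mem_Icc] at h₁ h₂
      have : M * K = K * M := by ring
      omega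
    rw [hunion, Finset.sum_union hdisj]
    congr 1
    refine Finset.sum_congr (by simp) fun t ht => ?_
    simp only [Finset.mem_Icc] at ht
    have : (t + K - 1) / K = M + 1 := by
      rw [Nat.div_eq_iff hK]
      have : (M + 1) * K = M * K + K := by ring
      rw [Nat.add_sub_cancel] at ht
      omega
    rw [this]

section QuadraticForm

variable {n : ℕ}

lemma inner_mulVecE_add (A B : Matrix (Fin n) (Fin n) ℝ) (u v : EuclideanSpace ℝ (Fin n)) :
    ⟪u, mulVecE (A + B) v⟫ = ⟪u, mulVecE A v⟫ + ⟪u, mulVecE B v⟫ := by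
  simp [mulVecE, inner_add_right]

lemma inner_mulVecE_sub (A B : Matrix (Fin n) (Fin n) ℝ) (u v : EuclideanSpace ℝ (Fin n)) :
    ⟪u, mulVecE (A - B) v⟫ = ⟪u, mulVecE A v⟫ - ⟪u, mulVecE B v⟫ := by
  simp [mulVecE, inner_sub_right]

lemma inner_mulVecE_smul_one (c : ℝ) (v : EuclideanSpace ℝ (Fin n)) :
    ⟪v, mulVecE (c • (1 : Matrix (Fin n) (Fin n) ℝ)) v⟫ = c * ‖v‖ ^ 2 := by
  simp [mulVecE, inner_smul_right]

lemma inner_mulVecE_vecMulVec (b v : EuclideanSpace ℝ (Fin n)) :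
    ⟪v, mulVecE (Matrix.vecMulVec (toVec b) (toVec b)) v⟫ = ⟪b, v⟫ ^ 2 := by
  have h : mulVecE (Matrix.vecMulVec (toVec b) (toVec b)) v = ⟪b, v⟫ • b := by
    ext i
    simp [mulVecE, toVec, Matrix.toLpLin_apply, Matrix.vecMulVec_mulVec, dotProduct,
      PiLp.inner_apply, mul_comm]
  rw [h, inner_smul_right, real_inner_comm]
  ring

lemma Matrix.PosSemidef.inner_mulVecE_nonneg {A : Matrix (Fin n) (Fin n) ℝ} (hA : A.PosSemidef)
    (v : EuclideanSpace ℝ (Fin n)) : 0 ≤ ⟪v, mulVecE A v⟫ := by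
  have h := hA.dotProduct_mulVec_nonneg (x := v.ofLp)
  simpa [mulVecE, Matrix.toLpLin_apply, PiLp.inner_apply, dotProduct, mul_comm] using h

lemma Matrix.IsHermitian.inner_mulVecE_comm {A : Matrix (Fin n) (Fin n) ℝ} (hA : A.IsHermitian)
    (u v : EuclideanSpace ℝ (Fin n)) : ⟪u, mulVecE A v⟫ = ⟪v, mulVecE A u⟫ := by
  have h := Matrix.isSymmetric_toEuclideanLin_iff.2 hA u v
  rw [mulVecE, mulVecE, ← h, real_inner_comm]

lemma mulVecE_nonsing_inv {A : Matrix (Fin n) (Fin n) ℝ} (hA : A.PosDef)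
    (v : EuclideanSpace ℝ (Fin n)) : mulVecE A (mulVecE A⁻¹ v) = v := by
  have h : A * A⁻¹ = 1 := Matrix.mul_nonsing_inv A ((Matrix.isUnit_iff_isUnit_det A).1 hA.isUnit)
  simp [mulVecE, Matrix.toLpLin_apply, h]

lemma sq_AnormE {A : Matrix (Fin n) (Fin n) ℝ} (hA : A.PosSemidef)
    (v : EuclideanSpace ℝ (Fin n)) : AnormE A v ^ 2 = ⟪v, mulVecE A v⟫ :=
  Real.sq_sqrt (hA.inner_mulVecE_nonneg v)

/-- Expansion of the quadratic form of `A` along a Newton step `u - c A⁻¹ b`. -/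
lemma inner_mulVecE_sub_smul_inv {A : Matrix (Fin n) (Fin n) ℝ} (hA : A.PosDef) (c : ℝ)
    (b u : EuclideanSpace ℝ (Fin n)) :
    ⟪u - c • mulVecE A⁻¹ b, mulVecE A (u - c • mulVecE A⁻¹ b)⟫ =
      ⟪u, mulVecE A u⟫ - 2 * c * ⟪b, u⟫ + c ^ 2 * ⟪b, mulVecE A⁻¹ b⟫ := by
  have h : mulVecE A (u - c • mulVecE A⁻¹ b) = mulVecE A u - c • b := by
    rw [← congrArg (c • ·) (mulVecE_nonsing_inv hA b)]
    simp only [mulVecE, map_sub, map_smul]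
  have h' : ⟪mulVecE A⁻¹ b, mulVecE A u⟫ = ⟪b, u⟫ := by
    rw [hA.1.inner_mulVecE_comm, mulVecE_nonsing_inv hA, real_inner_comm]
  rw [h]
  simp only [inner_sub_left, inner_sub_right, real_inner_smul_left, real_inner_smul_right, h']
  rw [real_inner_comm b u, real_inner_comm b (mulVecE A⁻¹ b)]
  ring

/-- The Cauchy–Schwarz inequality for the dual norms of `A` and `A⁻¹`. -/
lemma inner_le_sqrt_mul_AnormE {A : Matrix (Fin n) (Fin n) ℝ} (hA : A.PosDef)
    (b u : EuclideanSpace ℝ (Fin n)) :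
    ⟪b, u⟫ ≤ √⟪b, mulVecE A⁻¹ b⟫ * AnormE A u := by
  have hpos : ∀ c : ℝ, 0 ≤ ⟪b, mulVecE A⁻¹ b⟫ * (c * c) + (-2 * ⟪b, u⟫) * c +
      ⟪u, mulVecE A u⟫ := fun c => by
    have h := hA.posSemidef.inner_mulVecE_nonneg (u - c • mulVecE A⁻¹ b)
    rw [inner_mulVecE_sub_smul_inv hA] at h
    linarith
  have hd := discrim_le_zero hpos
  have hq := hA.inv.posSemidef.inner_mulVecE_nonneg b
  rw [AnormE, ← Real.sqrt_mul hq]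
  refine Real.le_sqrt_of_sq_le ?_
  rw [discrim] at hd
  linarith

end QuadraticForm

/-- Lemma 1 of the paper: regret bound for the Online Newton Step
template without feasibility, run with an approximately-feasible projection oracle. -/
theorem ons_without_feasibility_regret {n : ℕ} (R : ℝ) (hR : 0 < R)
    (Kset : Set (EuclideanSpace ℝ (Fin n))) (hKne : Kset.Nonempty)
    (hKconv : Convex ℝ Kset) (hKcomp : IsCompact Kset)
    (hKR : Kset ⊆ Metric.closedBall 0 R)
    (T K' : ℕ) (hT : 0 < T) (hK' : 0 < K') (hdvd : K' ∣ T)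
    (α β G ε εI η : ℝ) (hα : 0 < α) (hβ : 0 ≤ β) (hG : 0 < G) (hε : 0 < ε)
    (hεI : G ^ 2 * (K' : ℝ) ^ 2 ≤ εI)
    (hη : max (12 * (K' : ℝ) * G * R) (2 * (K' : ℝ) / α) ≤ η)
    (f : ℕ → EuclideanSpace ℝ (Fin n) → ℝ)
    (gf : ℕ → EuclideanSpace ℝ (Fin n) → EuclideanSpace ℝ (Fin n))
    -- the losses are convex and differentiable with gradient `gf t` on `3R·B`
    (hconv : ∀ t ∈ Finset.Icc 1 T,
      ConvexOn ℝ (Metric.closedBall 0 (3 * R)) (f t))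
    (hgrad : ∀ t ∈ Finset.Icc 1 T, ∀ u ∈ Metric.closedBall (0 : EuclideanSpace ℝ (Fin n)) (3 * R),
      HasGradientAt (f t) (gf t u) u)
    -- `β`-smoothness over `3R·B`
    (hsmooth : ∀ t ∈ Finset.Icc 1 T,
      ∀ u ∈ Metric.closedBall (0 : EuclideanSpace ℝ (Fin n)) (3 * R),
      ∀ v ∈ Metric.closedBall (0 : EuclideanSpace ℝ (Fin n)) (3 * R),
        ‖gf t u - gf t v‖ ≤ β * ‖u - v‖)
    -- gradients bounded by `G` over `3R·B`
    (hGb : ∀ t ∈ Finset.Icc 1 T, ∀ u ∈ Metric.closedBall (0 : EuclideanSpace ℝ (Fin n)) (3 * R),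
      ‖gf t u‖ ≤ G)
    -- curvature condition with parameter `α` over `3R·B` (a set of radius `3R`)
    (hcurv : ∀ t ∈ Finset.Icc 1 T, ∀ η' : ℝ, max (4 * G * (3 * R)) (2 / α) ≤ η' →
      ∀ u ∈ Metric.closedBall (0 : EuclideanSpace ℝ (Fin n)) (3 * R),
      ∀ w ∈ Metric.closedBall (0 : EuclideanSpace ℝ (Fin n)) (3 * R),
        f t u - f t w ≤ ⟪gf t u, u - w⟫ - 1 / (2 * η') * ⟪gf t u, u - w⟫ ^ 2)
    -- the iterates of the algorithm
    (x ytil yy : ℕ → EuclideanSpace ℝ (Fin n))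
    (A : ℕ → Matrix (Fin n) (Fin n) ℝ)
    (bar : ℕ → EuclideanSpace ℝ (Fin n))
    (hx1 : x 1 ∈ Kset) (hy1 : ytil 1 = x 1)
    (hA0 : A 0 = εI • (1 : Matrix (Fin n) (Fin n) ℝ))
    (hbar : ∀ m ∈ Finset.Icc 1 (T / K'),
      bar m = ∑ t ∈ Finset.Icc ((m - 1) * K' + 1) (m * K'), gf t (ytil m))
    (hAherm : ∀ m ∈ Finset.Icc 1 (T / K'), (A m).IsHermitian)
    (hAlow : ∀ m ∈ Finset.Icc 1 (T / K'), (A m - A 0).PosSemidef)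
    (hAup : ∀ m ∈ Finset.Icc 1 (T / K'),
      (A (m - 1) + Matrix.vecMulVec (toVec (bar m)) (toVec (bar m)) - A m).PosSemidef)
    (hyrec : ∀ m ∈ Finset.Icc 1 (T / K'),
      yy (m + 1) = ytil m - η • mulVecE (A m)⁻¹ (bar m))
    -- the approximately-feasible projection guarantees
    (hxK : ∀ m ∈ Finset.Icc 1 (T / K'), x (m + 1) ∈ Kset)
    (hAFP1 : ∀ m ∈ Finset.Icc 1 (T / K'), ∀ z ∈ Kset,
      AnormE (A m) (ytil (m + 1) - z) ≤ AnormE (A m) (yy (m + 1) - z))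
    (hAFP2 : ∀ m ∈ Finset.Icc 1 (T / K'),
      AnormE (A m) (x (m + 1) - ytil (m + 1)) ^ 2 ≤ 3 * ε)
    -- the infeasible iterates remain in `3R·B`
    (hyball : ∀ m ∈ Finset.Icc 1 (T / K'),
      ytil m ∈ Metric.closedBall (0 : EuclideanSpace ℝ (Fin n)) (3 * R)) :
    ∀ xx ∈ Kset,
      ∑ t ∈ Finset.Icc 1 T, (f t (x ((t + K' - 1) / K')) - f t xx) ≤
        3 * β * ε / εI * (T : ℝ) +
          Real.sqrt (6 * ε * (T : ℝ) / (K' : ℝ) *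
            ∑ m ∈ Finset.Icc 1 (T / K'), ⟪bar m, mulVecE (A m)⁻¹ (bar m)⟫) +
          2 * R ^ 2 * εI / η +
          η / 2 * ∑ m ∈ Finset.Icc 1 (T / K'), ⟪bar m, mulVecE (A m)⁻¹ (bar m)⟫ := by
  intro xx hxx
  obtain ⟨M, rfl⟩ := hdvd
  have hM : K' * M / K' = M := Nat.mul_div_cancel_left M hK'
  simp only [hM] at *
  have hK'r : (0 : ℝ) < K' := by exact_mod_cast hK'
  have hεI0 : 0 < εI := lt_of_lt_of_le (by positivity) hεI
  have hη0 : 0 < η := lt_of_lt_of_le (by positivity) ((le_max_left _ _).trans hη)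
  have hball : ∀ z ∈ Kset, z ∈ Metric.closedBall (0 : EuclideanSpace ℝ (Fin n)) (3 * R) :=
    fun z hz => Metric.closedBall_subset_closedBall (by linarith) (hKR hz)
  have hpd : ∀ m ≤ M, (A m).PosDef := by
    have h0 : (A 0).PosDef := by rw [hA0]; exact Matrix.PosDef.one.smul hεI0
    intro m hm
    rcases Nat.eq_zero_or_pos m with rfl | hm0
    · exact h0
    · have h := h0.add_posSemidef (hAlow m (Finset.mem_Icc.2 ⟨hm0, hm⟩))
      rwa [add_sub_cancel] at h
  have hlow : ∀ m ≤ M, ∀ v, εI * ‖v‖ ^ 2 ≤ ⟪v, mulVecE (A m) v⟫ := by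
    intro m hm v
    rw [← inner_mulVecE_smul_one, ← hA0]
    rcases Nat.eq_zero_or_pos m with rfl | hm0
    · exact le_rfl
    · have h := (hAlow m (Finset.mem_Icc.2 ⟨hm0, hm⟩)).inner_mulVecE_nonneg v
      rw [inner_mulVecE_sub] at h
      linarith
  have hup : ∀ m ∈ Finset.Icc 1 M, ∀ v,
      ⟪v, mulVecE (A m) v⟫ ≤ ⟪v, mulVecE (A (m - 1)) v⟫ + ⟪bar m, v⟫ ^ 2 := by
    intro m hm v
    have h := (hAup m hm).inner_mulVecE_nonneg v
    rw [inner_mulVecE_sub, inner_mulVecE_add, inner_mulVecE_vecMulVec] at h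
    linarith
  have hblock : ∀ m ∈ Finset.Icc 1 M, ∀ t ∈ Finset.Icc ((m - 1) * K' + 1) (m * K'),
      t ∈ Finset.Icc 1 (K' * M) := by
    intro m hm t ht
    simp only [Finset.mem_Icc] at hm ht ⊢
    refine ⟨by omega, ht.2.trans ?_⟩
    rw [mul_comm]
    exact Nat.mul_le_mul_left _ hm.2
  have hcard : ∀ m ∈ Finset.Icc 1 M, (Finset.Icc ((m - 1) * K' + 1) (m * K')).card = K' := by
    intro m hm
    obtain ⟨k, rfl⟩ : ∃ k, m = k + 1 := ⟨m - 1, by have := (Finset.mem_Icc.1 hm).1; omega⟩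
    rw [Nat.card_Icc, Nat.add_sub_cancel, Nat.add_sub_add_right, Nat.succ_mul]
    omega
  have hxmem : ∀ m ∈ Finset.Icc 1 M, x m ∈ Kset := by
    intro m hm
    obtain ⟨k, rfl⟩ : ∃ k, m = k + 1 := ⟨m - 1, by have := (Finset.mem_Icc.1 hm).1; omega⟩
    rcases Nat.eq_zero_or_pos k with rfl | hk
    · exact hx1
    · exact hxK k (Finset.mem_Icc.2 ⟨hk, by have := (Finset.mem_Icc.1 hm).2; omega⟩)
  have hdist : ∀ m ∈ Finset.Icc 1 M,
      ⟪x m - ytil m, mulVecE (A (m - 1)) (x m - ytil m)⟫ ≤ 3 * ε := by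
    intro m hm
    obtain ⟨k, rfl⟩ : ∃ k, m = k + 1 := ⟨m - 1, by have := (Finset.mem_Icc.1 hm).1; omega⟩
    have hkM : k + 1 ≤ M := (Finset.mem_Icc.1 hm).2
    rcases Nat.eq_zero_or_pos k with rfl | hk
    · simp [hy1, hε.le]
    · have h := hAFP2 k (Finset.mem_Icc.2 ⟨hk, by omega⟩)
      rwa [sq_AnormE (hpd k (by omega)).posSemidef] at h
  have hdist' : ∀ m ∈ Finset.Icc 1 M, ‖x m - ytil m‖ ^ 2 ≤ 3 * ε / εI := by
    intro m hm
    rw [le_div_iff₀ hεI0]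
    have := hlow (m - 1) (by have := (Finset.mem_Icc.1 hm).2; omega) (x m - ytil m)
    linarith [hdist m hm]
  have hbarG : ∀ m ∈ Finset.Icc 1 M, ‖bar m‖ ≤ K' * G := by
    intro m hm
    rw [hbar m hm]
    have h := norm_sum_le_of_le (Finset.Icc ((m - 1) * K' + 1) (m * K'))
      (fun t ht => hGb t (hblock m hm t ht) _ (hyball m hm))
    rwa [Finset.sum_const, hcard m hm, nsmul_eq_mul] at h
  have hdistA : ∀ m ∈ Finset.Icc 1 M, AnormE (A m) (x m - ytil m) ≤ √(6 * ε) := by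
    intro m hm
    refine Real.sqrt_le_sqrt ((hup m hm _).trans ?_)
    have hin : ⟪bar m, x m - ytil m⟫ ^ 2 ≤ εI * ‖x m - ytil m‖ ^ 2 := by
      calc ⟪bar m, x m - ytil m⟫ ^ 2 ≤ (‖bar m‖ * ‖x m - ytil m‖) ^ 2 := by
            rw [← sq_abs]
            exact pow_le_pow_left₀ (abs_nonneg _) (abs_real_inner_le_norm _ _) 2
        _ ≤ ((K' * G) * ‖x m - ytil m‖) ^ 2 := by
            gcongr
            exact hbarG m hm
        _ = G ^ 2 * (K' : ℝ) ^ 2 * ‖x m - ytil m‖ ^ 2 := by ring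
        _ ≤ εI * ‖x m - ytil m‖ ^ 2 := by gcongr
    have := hlow (m - 1) (by have := (Finset.mem_Icc.1 hm).2; omega) (x m - ytil m)
    linarith [hdist m hm]
  have hstepη : max (4 * G * (3 * R)) (2 / α) ≤ η / K' := by
    rw [le_div_iff₀ hK'r, max_mul_of_nonneg _ _ hK'r.le]
    refine le_trans (le_of_eq ?_) hη
    congr 1 <;> ring
  -- the cost of playing the feasible point `x m` instead of `ytil m`
  have hfeas : ∀ m ∈ Finset.Icc 1 M,
      ∑ t ∈ Finset.Icc ((m - 1) * K' + 1) (m * K'), (f t (x m) - f t (ytil m)) ≤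
        K' * (β * (3 * ε / εI)) + √(6 * ε) * √⟪bar m, mulVecE (A m)⁻¹ (bar m)⟫ := by
    intro m hm
    have hxm := hball _ (hxmem m hm)
    have hterm : ∀ t ∈ Finset.Icc ((m - 1) * K' + 1) (m * K'), f t (x m) - f t (ytil m) ≤
        β * (3 * ε / εI) + ⟪gf t (ytil m), x m - ytil m⟫ := by
      intro t ht
      have h := hcurv t (hblock m hm t ht) _ hstepη _ hxm _ (hyball m hm)
      have hsq : 0 ≤ 1 / (2 * (η / K')) * ⟪gf t (x m), x m - ytil m⟫ ^ 2 := by positivity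
      have hsm : ⟪gf t (x m) - gf t (ytil m), x m - ytil m⟫ ≤ β * ‖x m - ytil m‖ ^ 2 := by
        calc _ ≤ ‖gf t (x m) - gf t (ytil m)‖ * ‖x m - ytil m‖ := real_inner_le_norm _ _
          _ ≤ β * ‖x m - ytil m‖ * ‖x m - ytil m‖ := by
            gcongr
            exact hsmooth t (hblock m hm t ht) _ hxm _ (hyball m hm)
          _ = _ := by ring
      rw [inner_sub_left] at hsm
      have := mul_le_mul_of_nonneg_left (hdist' m hm) hβ
      linarith
    refine (Finset.sum_le_sum hterm).trans ?_
    rw [Finset.sum_add_distrib, Finset.sum_const, hcard m hm, nsmul_eq_mul, ← sum_inner,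
      ← hbar m hm]
    have h := inner_le_sqrt_mul_AnormE (hpd m (Finset.mem_Icc.1 hm).2) (bar m) (x m - ytil m)
    have h' := mul_le_mul_of_nonneg_left (hdistA m hm)
      (Real.sqrt_nonneg ⟪bar m, mulVecE (A m)⁻¹ (bar m)⟫)
    linarith
  -- the regret of the infeasible iterates
  have hinf : ∀ m ∈ Finset.Icc 1 M,
      ∑ t ∈ Finset.Icc ((m - 1) * K' + 1) (m * K'), (f t (ytil m) - f t xx) ≤
        1 / (2 * η) * (⟪ytil m - xx, mulVecE (A (m - 1)) (ytil m - xx)⟫ -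
          ⟪ytil (m + 1) - xx, mulVecE (A m) (ytil (m + 1) - xx)⟫) +
        η / 2 * ⟪bar m, mulVecE (A m)⁻¹ (bar m)⟫ := by
    intro m hm
    have hpm := hpd m (Finset.mem_Icc.1 hm).2
    have hcurvsum : ∑ t ∈ Finset.Icc ((m - 1) * K' + 1) (m * K'), (f t (ytil m) - f t xx) ≤
        ⟪bar m, ytil m - xx⟫ - 1 / (2 * η) * ⟪bar m, ytil m - xx⟫ ^ 2 := by
      refine (Finset.sum_le_sum fun t ht => hcurv t (hblock m hm t ht) _ hstepη _
        (hyball m hm) _ (hball _ hxx)).trans ?_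
      rw [Finset.sum_sub_distrib, ← Finset.mul_sum, ← sum_inner, ← hbar m hm]
      have hcs := sq_sum_le_card_mul_sum_sq (s := Finset.Icc ((m - 1) * K' + 1) (m * K'))
        (f := fun t => ⟪gf t (ytil m), ytil m - xx⟫)
      rw [hcard m hm, ← sum_inner, ← hbar m hm] at hcs
      have h := mul_le_mul_of_nonneg_left hcs (show 0 ≤ 1 / (2 * η) by positivity)
      have heq : 1 / (2 * (η / K')) = 1 / (2 * η) * K' := by field_simp
      rw [heq]
      linarith
    have hproj : ⟪ytil (m + 1) - xx, mulVecE (A m) (ytil (m + 1) - xx)⟫ ≤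
        ⟪ytil m - xx, mulVecE (A m) (ytil m - xx)⟫ - 2 * η * ⟪bar m, ytil m - xx⟫ +
          η ^ 2 * ⟪bar m, mulVecE (A m)⁻¹ (bar m)⟫ := by
      have h := pow_le_pow_left₀ (Real.sqrt_nonneg _) (hAFP1 m hm xx hxx) 2
      rw [← AnormE, sq_AnormE hpm.posSemidef, sq_AnormE hpm.posSemidef, hyrec m hm, sub_right_comm,
        inner_mulVecE_sub_smul_inv hpm] at h
      exact h
    have h := mul_le_mul_of_nonneg_left (hproj.trans (add_le_add_left (sub_le_sub_right
      (hup m hm (ytil m - xx)) _) _)) (show 0 ≤ 1 / (2 * η) by positivity)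
    have hexp : 1 / (2 * η) * (⟪ytil m - xx, mulVecE (A (m - 1)) (ytil m - xx)⟫ +
        ⟪bar m, ytil m - xx⟫ ^ 2 - 2 * η * ⟪bar m, ytil m - xx⟫ +
          η ^ 2 * ⟪bar m, mulVecE (A m)⁻¹ (bar m)⟫) =
        1 / (2 * η) * ⟪ytil m - xx, mulVecE (A (m - 1)) (ytil m - xx)⟫ +
          1 / (2 * η) * ⟪bar m, ytil m - xx⟫ ^ 2 - ⟪bar m, ytil m - xx⟫ +
          η / 2 * ⟪bar m, mulVecE (A m)⁻¹ (bar m)⟫ := by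
      field_simp
    rw [hexp] at h
    linarith
  have htel : ∑ m ∈ Finset.Icc 1 M, (⟪ytil m - xx, mulVecE (A (m - 1)) (ytil m - xx)⟫ -
      ⟪ytil (m + 1) - xx, mulVecE (A m) (ytil (m + 1) - xx)⟫) ≤ 4 * R ^ 2 * εI := by
    have hsum : ∀ N, ∑ m ∈ Finset.Icc 1 N, (⟪ytil m - xx, mulVecE (A (m - 1)) (ytil m - xx)⟫ -
        ⟪ytil (m + 1) - xx, mulVecE (A m) (ytil (m + 1) - xx)⟫) =
        ⟪ytil 1 - xx, mulVecE (A 0) (ytil 1 - xx)⟫ -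
          ⟪ytil (N + 1) - xx, mulVecE (A N) (ytil (N + 1) - xx)⟫ := by
      intro N
      induction N with
      | zero => simp
      | succ N ih => rw [Finset.sum_Icc_succ_top (by omega), ih, Nat.add_sub_cancel]; ring
    rw [hsum, hA0, inner_mulVecE_smul_one, hy1]
    have hend := (hpd M le_rfl).posSemidef.inner_mulVecE_nonneg (ytil (M + 1) - xx)
    have hn : ‖x 1 - xx‖ ≤ 2 * R := by
      have h₁ := mem_closedBall_zero_iff.1 (hKR hx1)
      have h₂ := mem_closedBall_zero_iff.1 (hKR hxx)
      linarith [norm_sub_le (x 1) xx]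
    have := mul_le_mul_of_nonneg_left (pow_le_pow_left₀ (norm_nonneg _) hn 2) hεI0.le
    linarith
  have hsqrt : ∑ m ∈ Finset.Icc 1 M, √(6 * ε) * √⟪bar m, mulVecE (A m)⁻¹ (bar m)⟫ ≤
      √(6 * ε * ((K' * M : ℕ) : ℝ) / K' *
        ∑ m ∈ Finset.Icc 1 M, ⟪bar m, mulVecE (A m)⁻¹ (bar m)⟫) := by
    refine Real.le_sqrt_of_sq_le ?_
    have hcs := sq_sum_le_card_mul_sum_sq (s := Finset.Icc 1 M)
      (f := fun m => √⟪bar m, mulVecE (A m)⁻¹ (bar m)⟫)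
    rw [Finset.sum_congr rfl fun m hm => Real.sq_sqrt
      ((hpd m (Finset.mem_Icc.1 hm).2).inv.posSemidef.inner_mulVecE_nonneg (bar m)),
      Nat.card_Icc, Nat.add_sub_cancel] at hcs
    rw [← Finset.mul_sum, mul_pow, Real.sq_sqrt (by positivity)]
    have heq : 6 * ε * ((K' * M : ℕ) : ℝ) / K' = 6 * ε * M := by
      push_cast
      field_simp
    rw [heq, mul_assoc (6 * ε)]
    gcongr
  rw [sum_Icc_mul_eq_sum_blocks hK' (fun t m => f t (x m) - f t xx)]
  have hsplit : ∀ m ∈ Finset.Icc 1 M,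
      ∑ t ∈ Finset.Icc ((m - 1) * K' + 1) (m * K'), (f t (x m) - f t xx) ≤
        (K' * (β * (3 * ε / εI)) + √(6 * ε) * √⟪bar m, mulVecE (A m)⁻¹ (bar m)⟫) +
        (1 / (2 * η) * (⟪ytil m - xx, mulVecE (A (m - 1)) (ytil m - xx)⟫ -
          ⟪ytil (m + 1) - xx, mulVecE (A m) (ytil (m + 1) - xx)⟫) +
        η / 2 * ⟪bar m, mulVecE (A m)⁻¹ (bar m)⟫) := by
    intro m hm
    refine le_trans (le_of_eq ?_) (add_le_add (hfeas m hm) (hinf m hm))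
    rw [← Finset.sum_add_distrib]
    exact Finset.sum_congr rfl fun t _ => by ring
  refine (Finset.sum_le_sum hsplit).trans ?_
  rw [Finset.sum_add_distrib, Finset.sum_add_distrib, Finset.sum_add_distrib,
    ← Finset.mul_sum _ _ (1 / (2 * η)), ← Finset.mul_sum _ _ (η / 2), Finset.sum_const,
    Nat.card_Icc, Nat.add_sub_cancel, nsmul_eq_mul]
  have h₁ : (M : ℝ) * (K' * (β * (3 * ε / εI))) = 3 * β * ε / εI * ((K' * M : ℕ) : ℝ) := by
    push_cast
    ring
  have h₂ := mul_le_mul_of_nonneg_left htel (show 0 ≤ 1 / (2 * η) by positivity)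
  have h₃ : 1 / (2 * η) * (4 * R ^ 2 * εI) = 2 * R ^ 2 * εI / η := by
    field_simp
    ring
  rw [h₃] at h₂
  linarith
end
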